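/- arXiv:1404.2348 — 2 statements merged into one kernel-verified Lean document; each statement's English description precedes it below -/
import Mathlib

section
/- Fix real parameters α, G, B > 0 and a positive integer K, and define the revenue function R(p) = p·min{G·e^{−1−p/α}, K·B} for p ∈ (0, ∞). If K·B ≤ G·e^{−2}, then the price p* = α(ln(G/(K·B)) − 1) satisfies p* ≥ α, G·e^{−1−p*/α} = K·B, and R(p) ≤ R(p*) = α(ln(G/(K·B)) − 1)·K·B for every p > 0. If instead K·B > G·e^{−2}, then R(p) ≤ R(α) = α·G·e^{−2} for every p > 0. -/
/-- On the side of `q` where `(p - q) * (q - α)` is nonnegative, `p ↦ p * exp (-1 - p / α)`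
stays below its value at `q`. -/
lemma mul_exp_neg_one_sub_div_le {α p q : ℝ} (hα : 0 < α) (hpq : 0 ≤ (p - q) * (q - α))
    (hq : 0 < q) :
    p * Real.exp (-1 - p / α) ≤ q * Real.exp (-1 - q / α) := by
  have hp : p ≤ q * ((p - q) / α + 1) := by
    have h : q * ((p - q) / α + 1) - p = (p - q) * (q - α) / α := by
      field_simp
      ring
    have := div_nonneg hpq hα.le
    linarith
  have hexp : Real.exp (-1 - q / α) = Real.exp ((p - q) / α) * Real.exp (-1 - p / α) := by
    rw [← Real.exp_add]
    congr 1
    ring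
  rw [hexp, ← mul_assoc]
  gcongr
  exact hp.trans (by gcongr; exact Real.add_one_le_exp _)

/-- Optimal pricing rule (Eq. (9) of the paper).  For `α, G, B > 0` and a positive
integer `K`, with revenue `R(p) = p·min{G·e^{−1−p/α}, K·B}` on `(0,∞)`:
if `K·B ≤ G·e^{−2}` then `p* = α(ln(G/(K·B)) − 1)` satisfies `p* ≥ α`,
`G·e^{−1−p*/α} = K·B` and `R(p) ≤ R(p*) = α(ln(G/(K·B)) − 1)·K·B` for all `p > 0`;
if `K·B > G·e^{−2}` then `R(p) ≤ R(α) = α·G·e^{−2}` for all `p > 0`. -/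
theorem wsp_optimal_price (α G B : ℝ) (hα : 0 < α) (hG : 0 < G) (hB : 0 < B)
    (K : ℕ) (hK : 1 ≤ K)
    (R : ℝ → ℝ)
    (hR : ∀ p : ℝ, R p = p * min (G * Real.exp (-1 - p / α)) ((K : ℝ) * B)) :
    ((K : ℝ) * B ≤ G * Real.exp (-2) →
      α ≤ α * (Real.log (G / ((K : ℝ) * B)) - 1) ∧
      G * Real.exp (-1 - (α * (Real.log (G / ((K : ℝ) * B)) - 1)) / α) = (K : ℝ) * B ∧
      (∀ p : ℝ, 0 < p → R p ≤ R (α * (Real.log (G / ((K : ℝ) * B)) - 1))) ∧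
      R (α * (Real.log (G / ((K : ℝ) * B)) - 1))
        = α * (Real.log (G / ((K : ℝ) * B)) - 1) * ((K : ℝ) * B)) ∧
    (G * Real.exp (-2) < (K : ℝ) * B →
      (∀ p : ℝ, 0 < p → R p ≤ R α) ∧ R α = α * G * Real.exp (-2)) := by
  have hC : 0 < (K : ℝ) * B := mul_pos (by exact_mod_cast hK) hB
  generalize (K : ℝ) * B = C at hC hR ⊢
  refine ⟨fun h => ?_, fun h => ?_⟩
  · have hlog : 2 ≤ Real.log (G / C) := by
      rw [Real.le_log_iff_exp_le (div_pos hG hC), le_div_iff₀ hC]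
      calc Real.exp 2 * C ≤ Real.exp 2 * (G * Real.exp (-2)) := by gcongr
        _ = G := by rw [Real.exp_neg]; field_simp
    have hdemand : G * Real.exp (-1 - (α * (Real.log (G / C) - 1)) / α) = C := by
      rw [mul_div_cancel_left₀ _ hα.ne',
        show -1 - (Real.log (G / C) - 1) = -Real.log (G / C) by ring,
        Real.exp_neg, Real.exp_log (div_pos hG hC)]
      field_simp
    have hle : α ≤ α * (Real.log (G / C) - 1) := by nlinarith
    generalize α * (Real.log (G / C) - 1) = q at hdemand hle ⊢
    have hRq : R q = q * C := by rw [hR, hdemand, min_self]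
    refine ⟨hle, hdemand, fun p hp => ?_, hRq⟩
    rw [hRq, hR]
    rcases le_total p q with hpq | hqp
    · exact mul_le_mul hpq (min_le_right _ _) (by positivity) (hp.le.trans hpq)
    · calc p * min (G * Real.exp (-1 - p / α)) C ≤ p * (G * Real.exp (-1 - p / α)) := by
            gcongr
            exact min_le_left _ _
        _ = G * (p * Real.exp (-1 - p / α)) := by ring
        _ ≤ G * (q * Real.exp (-1 - q / α)) := by
            gcongr G * ?_
            exact mul_exp_neg_one_sub_div_le hα
              (mul_nonneg (sub_nonneg.2 hqp) (sub_nonneg.2 hle)) (hα.trans_le hle)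
        _ = q * C := by rw [← hdemand]; ring
  · have hexp : -1 - α / α = -2 := by
      rw [div_self hα.ne']
      norm_num
    have hRα : R α = α * G * Real.exp (-2) := by
      rw [hR, hexp, min_eq_left h.le, mul_assoc]
    refine ⟨fun p hp => ?_, hRα⟩
    rw [hRα, hR]
    calc p * min (G * Real.exp (-1 - p / α)) C ≤ p * (G * Real.exp (-1 - p / α)) := by
          gcongr
          exact min_le_left _ _
      _ = G * (p * Real.exp (-1 - p / α)) := by ring
      _ ≤ G * (α * Real.exp (-1 - α / α)) := by
          gcongr G * ?_
          exact mul_exp_neg_one_sub_div_le hα (by simp) hα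
      _ = α * G * Real.exp (-2) := by rw [hexp]; ring
end

section
/- Let α, G, B > 0 be real. Define F(0) = 0 and, for each integer k ≥ 1, F(k) = α·(ln(G/(k·B)) − 1)·k·B if k·B ≤ G·e^{−2}, and F(k) = α·G·e^{−2} otherwise. Define the marginal true value b̃_k = F(k) − F(k−1) for each integer k ≥ 1. Then the sequence (b̃_k) is nonincreasing: b̃_k ≥ b̃_{k+1} for every k ≥ 1. -/
/-- Tangent-line bound for the concave function `x ↦ (log (G / x) - 1) * x`. -/
lemma log_div_sub_one_mul_le {G x : ℝ} (hG : 0 < G) (hx : 0 < x) (t : ℝ) :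
    (Real.log (G / x) - 1) * x ≤ t * x + G * Real.exp (-2) * Real.exp (-t) := by
  have h := Real.add_one_le_exp (Real.log (G / x) + (-2 + -t))
  rw [Real.exp_add, Real.exp_add, Real.exp_log (div_pos hG hx)] at h
  have h' := mul_le_mul_of_nonneg_right h hx.le
  have e : G / x * (Real.exp (-2) * Real.exp (-t)) * x =
      G * Real.exp (-2) * Real.exp (-t) := by
    field_simp
  rw [e] at h'
  linarith

/-- Equality in `log_div_sub_one_mul_le` at the slope `log (G / x) - 2`. -/
lemma log_div_sub_one_mul_eq {G x : ℝ} (hG : 0 < G) (hx : 0 < x) :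
    (Real.log (G / x) - 1) * x = (Real.log (G / x) - 2) * x +
      G * Real.exp (-2) * Real.exp (-(Real.log (G / x) - 2)) := by
  have e : Real.exp (-2) * Real.exp (-(Real.log (G / x) - 2)) = x / G := by
    rw [← Real.exp_add, show -2 + -(Real.log (G / x) - 2) = -Real.log (G / x) by ring,
      Real.exp_neg, Real.exp_log (div_pos hG hx), inv_div]
  rw [mul_assoc G, e, mul_div_cancel₀ x hG.ne']
  ring

/-- A constant beyond the maximiser is dominated by every line of nonnegative slope. -/
lemma le_mul_add_mul_exp_neg {c x t : ℝ} (hc : 0 ≤ c) (hcx : c ≤ x) (ht : 0 ≤ t) :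
    c ≤ t * x + c * Real.exp (-t) := by
  have h := mul_le_mul_of_nonneg_left (Real.add_one_le_exp (-t)) hc
  have h' := mul_le_mul_of_nonneg_left hcx ht
  linarith

/-- Theorem 1 of the paper (marginal decreasing bids).  With `F(0) = 0` and, for
`k ≥ 1`, `F(k) = α·(ln(G/(k·B)) − 1)·k·B` if `k·B ≤ G·e^{−2}` and
`F(k) = α·G·e^{−2}` otherwise, the marginal true values `b̃_k = F(k) − F(k−1)`
form a nonincreasing sequence: `b̃_{k+1} ≤ b̃_k` for every `k ≥ 1`. -/
theorem marginal_bids_nonincreasing (α G B : ℝ) (hα : 0 < α) (hG : 0 < G) (hB : 0 < B)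
    (F : ℕ → ℝ) (hF0 : F 0 = 0)
    (hF : ∀ k : ℕ, 1 ≤ k →
      F k = if (k : ℝ) * B ≤ G * Real.exp (-2)
            then α * (Real.log (G / ((k : ℝ) * B)) - 1) * ((k : ℝ) * B)
            else α * G * Real.exp (-2)) :
    ∀ k : ℕ, 1 ≤ k → F (k + 1) - F k ≤ F k - F (k - 1) := by
  have upper : ∀ t : ℝ, 0 ≤ t → ∀ k : ℕ,
      F k ≤ α * (t * (k * B) + G * Real.exp (-2) * Real.exp (-t)) := by
    intro t ht k
    rcases Nat.eq_zero_or_pos k with rfl | hk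
    · rw [hF0]
      positivity
    · have hx : 0 < (k : ℝ) * B := mul_pos (Nat.cast_pos.mpr hk) hB
      rw [hF k hk]
      split_ifs with h
      · rw [mul_assoc]
        exact mul_le_mul_of_nonneg_left (log_div_sub_one_mul_le hG hx t) hα.le
      · rw [mul_assoc]
        exact mul_le_mul_of_nonneg_left
          (le_mul_add_mul_exp_neg (by positivity) (not_le.mp h).le ht) hα.le
  have attained : ∀ k : ℕ, 1 ≤ k → ∃ t : ℝ, 0 ≤ t ∧
      F k = α * (t * (k * B) + G * Real.exp (-2) * Real.exp (-t)) := by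
    intro k hk
    have hx : 0 < (k : ℝ) * B := mul_pos (Nat.cast_pos.mpr hk) hB
    rw [hF k hk]
    split_ifs with h
    · refine ⟨Real.log (G / (k * B)) - 2, ?_, ?_⟩
      · rw [sub_nonneg, Real.le_log_iff_exp_le (div_pos hG hx), le_div_iff₀ hx]
        calc Real.exp 2 * (k * B) ≤ Real.exp 2 * (G * Real.exp (-2)) := by gcongr
          _ = G := by rw [mul_left_comm, ← Real.exp_add]; simp
      · rw [mul_assoc, ← log_div_sub_one_mul_eq hG hx]
    · exact ⟨0, le_rfl, by simp [mul_assoc]⟩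
  intro k hk
  obtain ⟨t, ht, hFk⟩ := attained k hk
  have hnext := upper t ht (k + 1)
  have hprev := upper t ht (k - 1)
  push_cast [Nat.cast_sub hk] at hnext hprev
  linarith
end
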